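/- arXiv:2507.11688 — 2 statements merged into one kernel-verified Lean document; each statement's English description precedes it below -/
import Mathlib

section
/- Let n : ℕ, let Q be the standard quadratic form on ℝⁿ = Fin n → ℝ, and let B be an n×n real skew-symmetric matrix (Bᵀ = -B). Define the bivector b = ∑_{i<j} B i j • (ι(e i) * ι(e j)) in CliffordAlgebra Q. Then for every v ∈ ℝⁿ, the commutator of b with ι(v) satisfies b * ι(v) - ι(v) * b = ι(2 • B.mulVec v). -/
open Matrix CliffordAlgebra

/-- The standard (Euclidean) quadratic form on `ℝⁿ`, `Q x = ∑ i, (x i)²`. -/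
noncomputable def Qstd (n : ℕ) : QuadraticForm ℝ (Fin n → ℝ) :=
  QuadraticMap.weightedSumSquares ℝ (fun _ : Fin n => (1 : ℝ))

theorem polar_Qstd_single (n : ℕ) (i : Fin n) (v : Fin n → ℝ) :
    QuadraticMap.polar (Qstd n) (Pi.single i 1) v = 2 * v i := by
  have h : ∀ x : Fin n, (Pi.single i (1 : ℝ) + v : Fin n → ℝ) x * (Pi.single i (1 : ℝ) + v : Fin n → ℝ) x
      - (Pi.single i (1 : ℝ) : Fin n → ℝ) x * (Pi.single i (1 : ℝ) : Fin n → ℝ) x - v x * v x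
      = if x = i then 2 * v x else 0 := by
    intro x
    by_cases hx : x = i
    · subst hx
      simp only [Pi.add_apply, Pi.single_eq_same, if_true]
      ring
    · simp [hx]
  simp only [QuadraticMap.polar, Qstd, QuadraticMap.weightedSumSquares_apply, one_smul,
    ← Finset.sum_sub_distrib, h]
  simp

/-- The commutator of a product of two vectors with a vector is a vector. -/
theorem ι_mul_ι_commutator_ι {R M : Type*} [CommRing R] [AddCommGroup M] [Module R M]
    (Q : QuadraticForm R M) (x y v : M) :
    ι Q x * ι Q y * ι Q v - ι Q v * (ι Q x * ι Q y)
      = ι Q (QuadraticMap.polar Q y v • x - QuadraticMap.polar Q x v • y) := by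
  calc ι Q x * ι Q y * ι Q v - ι Q v * (ι Q x * ι Q y)
      = ι Q x * (ι Q y * ι Q v + ι Q v * ι Q y)
        - (ι Q x * ι Q v + ι Q v * ι Q x) * ι Q y := by noncomm_ring
    _ = _ := by
      rw [ι_mul_ι_add_swap, ι_mul_ι_add_swap, ← Algebra.commutes, map_sub, map_smul, map_smul,
        Algebra.smul_def, Algebra.smul_def]

/-- Summing `f i j + f j i` over `i < j` gives the sum of `f` if `f` vanishes on the diagonal. -/
theorem sum_sum_ite_lt_add_swap {κ M : Type*} [Fintype κ] [LinearOrder κ] [AddCommMonoid M]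
    (f : κ → κ → M) (hf : ∀ i, f i i = 0) :
    (∑ i, ∑ j, if i < j then f i j + f j i else 0) = ∑ i, ∑ j, f i j := by
  have h₁ : (∑ i, ∑ j, if i < j then f i j + f j i else 0)
      = (∑ i, ∑ j, if i < j then f i j else 0) + ∑ i, ∑ j, if i < j then f j i else 0 := by
    simp only [← Finset.sum_add_distrib]
    refine Finset.sum_congr rfl fun i _ => Finset.sum_congr rfl fun j _ => ?_
    split_ifs <;> simp
  rw [h₁, Finset.sum_comm (f := fun i j => if i < j then f j i else 0)]
  simp only [← Finset.sum_add_distrib]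
  refine Finset.sum_congr rfl fun i _ => Finset.sum_congr rfl fun j _ => ?_
  rcases lt_trichotomy i j with h | rfl | h
  · simp [h, h.not_gt]
  · simp [hf]
  · simp [h, h.not_gt]

/-- For a skew-symmetric matrix `B` and the corresponding bivector
`b = ∑_{i<j} B i j • (ι(e i) * ι(e j))`, the commutator identity
`b * ι(v) - ι(v) * b = ι(2 • B v)` holds for every vector `v`. -/
theorem bivector_commutator_eq_ι_two_smul_mulVec (n : ℕ)
    (B : Matrix (Fin n) (Fin n) ℝ) (hB : Bᵀ = -B)
    (b : CliffordAlgebra (Qstd n))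
    (hb : b = ∑ i : Fin n, ∑ j : Fin n,
      if i < j then
        B i j • (ι (Qstd n) (Pi.single i (1 : ℝ)) * ι (Qstd n) (Pi.single j (1 : ℝ)))
      else 0)
    (v : Fin n → ℝ) :
    b * ι (Qstd n) v - ι (Qstd n) v * b = ι (Qstd n) ((2 : ℝ) • B.mulVec v) := by
  have hskew (i j : Fin n) : B j i = -B i j := congrFun (congrFun hB i) j
  have hterm (i j : Fin n) :
      (if i < j then B i j • (ι (Qstd n) (Pi.single i 1) * ι (Qstd n) (Pi.single j 1)) else 0)
          * ι (Qstd n) v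
        - ι (Qstd n) v *
          (if i < j then B i j • (ι (Qstd n) (Pi.single i 1) * ι (Qstd n) (Pi.single j 1)) else 0)
      = ι (Qstd n) (if i < j then
          (2 * B i j * v j) • Pi.single i 1 + (2 * B j i * v i) • Pi.single j 1 else 0) := by
    split_ifs
    · rw [smul_mul_assoc, mul_smul_comm, ← smul_sub, ι_mul_ι_commutator_ι, polar_Qstd_single,
        polar_Qstd_single, ← map_smul, hskew i j]
      congr 1
      module
    · simp
  rw [hb]
  simp only [Finset.sum_mul, Finset.mul_sum, ← Finset.sum_sub_distrib, hterm, ← map_sum]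
  rw [sum_sum_ite_lt_add_swap (fun i j : Fin n => (2 * B i j * v j) • Pi.single i (1 : ℝ))]
  · congr 1
    ext k
    simp [Finset.sum_apply, Pi.single_apply, Matrix.mulVec, dotProduct, Finset.mul_sum, mul_assoc]
  · intro i
    have hdiag : B i i = 0 := by linarith [hskew i i]
    simp [hdiag]
end

section
/- Every n×n real skew-symmetric matrix B can be written as a sum B = ∑_{i=1}^{⌊n/2⌋} B_i of at most ⌊n/2⌋ skew-symmetric matrices B_i, each of rank at most 2, such that B_i * B_j = 0 whenever i ≠ j (in particular the B_i pairwise commute and have mutually orthogonal column spaces). -/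
open Matrix

section SkewSymmetric

variable {m : Type*} [Fintype m]

theorem Matrix.mulVec_dotProduct_of_transpose_eq_neg {B : Matrix m m ℝ} (hB : Bᵀ = -B)
    (x y : m → ℝ) : (B *ᵥ x) ⬝ᵥ y = -(x ⬝ᵥ (B *ᵥ y)) := by
  rw [dotProduct_mulVec, ← mulVec_transpose, hB, neg_mulVec, neg_dotProduct, neg_neg]

/-- A nonzero skew-symmetric real matrix has an eigenvector of its square for a nonzero
eigenvalue. -/
theorem Matrix.exists_mulVec_mulVec_eq_smul_of_transpose_eq_neg {B : Matrix m m ℝ}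
    (hB : Bᵀ = -B) (hB0 : B ≠ 0) :
    ∃ v : m → ℝ, ∃ e : ℝ, v ≠ 0 ∧ e ≠ 0 ∧ B *ᵥ (B *ᵥ v) = e • v := by
  classical
  have hS : (B * B).IsHermitian := by
    simp [IsHermitian, conjTranspose_eq_transpose_of_trivial, transpose_mul, hB]
  have hS0 : B * B ≠ 0 := by
    intro h
    apply hB0
    rw [← conjTranspose_mul_self_eq_zero, conjTranspose_eq_transpose_of_trivial, hB]
    simp [h]
  obtain ⟨i, hi⟩ := Function.ne_iff.mp (mt hS.eigenvalues_eq_zero_iff.mp hS0)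
  refine ⟨hS.eigenvectorBasis i, hS.eigenvalues i, fun h => ?_, hi, ?_⟩
  · exact hS.eigenvectorBasis.orthonormal.ne_zero i (by ext j; exact congrFun h j)
  · rw [mulVec_mulVec]
    exact hS.mulVec_eigenvectorBasis i

/-- If `A` annihilates two orthogonal nonzero vectors that are orthogonal to `ker B`, and
`ker B ≤ ker A`, then the rank of `A` is at least two less than that of `B`. -/
theorem Matrix.rank_add_two_le_of_ker_le {A B : Matrix m m ℝ} {v w : m → ℝ}
    (hv : v ≠ 0) (hw : w ≠ 0) (hvw : v ⬝ᵥ w = 0) (hAv : A *ᵥ v = 0) (hAw : A *ᵥ w = 0)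
    (hBv : ∀ x, B *ᵥ x = 0 → v ⬝ᵥ x = 0) (hBw : ∀ x, B *ᵥ x = 0 → w ⬝ᵥ x = 0)
    (hBA : ∀ x, B *ᵥ x = 0 → A *ᵥ x = 0) : A.rank + 2 ≤ B.rank := by
  have hli : LinearIndependent ℝ ![v, w] := by
    rw [LinearIndependent.pair_iff]
    intro s t h
    have h1 := congrArg (v ⬝ᵥ ·) h
    have h2 := congrArg (w ⬝ᵥ ·) h
    simp only [dotProduct_add, dotProduct_smul, dotProduct_comm w v, hvw, dotProduct_zero,
      smul_eq_mul, mul_zero, add_zero, zero_add, mul_eq_zero, dotProduct_self_eq_zero, hv, hw,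
      or_false] at h1 h2
    exact ⟨h1, h2⟩
  have hspan : Module.finrank ℝ (Submodule.span ℝ {v, w}) = 2 := by
    rw [← range_cons_cons_empty v w ![]]
    exact finrank_span_eq_card hli
  have hinf : LinearMap.ker B.mulVecLin ⊓ Submodule.span ℝ {v, w} = ⊥ := by
    rw [Submodule.eq_bot_iff]
    rintro x ⟨hx, hxs⟩
    have hx' : B *ᵥ x = 0 := by simpa using hx
    obtain ⟨a, b, hab⟩ := Submodule.mem_span_pair.mp hxs
    rw [← dotProduct_self_eq_zero]
    nth_rewrite 1 [← hab]
    simp [add_dotProduct, smul_dotProduct, hBv x hx', hBw x hx']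
  have hsup : LinearMap.ker B.mulVecLin ⊔ Submodule.span ℝ {v, w} ≤
      LinearMap.ker A.mulVecLin := by
    refine sup_le (fun x hx => ?_) (Submodule.span_le.mpr ?_)
    · simpa using hBA x (by simpa using hx)
    · rintro x (rfl | rfl)
      · simpa using hAv
      · simpa using hAw
  have hdim := Submodule.finrank_sup_add_finrank_inf_eq
    (LinearMap.ker B.mulVecLin) (Submodule.span ℝ {v, w})
  rw [hinf, finrank_bot, hspan] at hdim
  have hle := Submodule.finrank_mono hsup
  have hA := A.mulVecLin.finrank_range_add_finrank_ker
  have hB := B.mulVecLin.finrank_range_add_finrank_ker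
  unfold Matrix.rank
  omega

/-- A nonzero skew-symmetric real matrix splits off a skew-symmetric summand of rank at most two,
decreasing the rank by two. -/
theorem Matrix.exists_rank_two_summand_of_transpose_eq_neg {B : Matrix m m ℝ}
    (hB : Bᵀ = -B) (hB0 : B ≠ 0) :
    ∃ C : Matrix m m ℝ, Cᵀ = -C ∧ C.rank ≤ 2 ∧ (B - C) * C = 0 ∧
      (B - C).rank + 2 ≤ B.rank ∧ ∀ x, B *ᵥ x = 0 → C *ᵥ x = 0 := by
  obtain ⟨v, e, hv, he, hBBv⟩ := exists_mulVec_mulVec_eq_smul_of_transpose_eq_neg hB hB0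
  set w := B *ᵥ v with hw_def
  have hvv : v ⬝ᵥ v ≠ 0 := by simpa using hv
  have hvw : v ⬝ᵥ w = 0 := by
    have h := mulVec_dotProduct_of_transpose_eq_neg hB v v
    rw [← hw_def, dotProduct_comm] at h
    linarith
  have hww : w ⬝ᵥ w = -(e * (v ⬝ᵥ v)) := by
    have h := mulVec_dotProduct_of_transpose_eq_neg hB v w
    rwa [← hw_def, hBBv, dotProduct_smul, smul_eq_mul] at h
  have hw : w ≠ 0 := by
    intro h
    rw [h, dotProduct_zero, eq_comm, neg_eq_zero] at hww
    exact mul_ne_zero he hvv hww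
  have hwx : ∀ x, B *ᵥ x = 0 → w ⬝ᵥ x = 0 := fun x hx => by
    rw [hw_def, mulVec_dotProduct_of_transpose_eq_neg hB, hx, dotProduct_zero, neg_zero]
  have hvx : ∀ x, B *ᵥ x = 0 → v ⬝ᵥ x = 0 := fun x hx => by
    have h := mulVec_dotProduct_of_transpose_eq_neg hB w x
    rw [hBBv, hx, dotProduct_zero, neg_zero, smul_dotProduct, smul_eq_mul] at h
    exact (mul_eq_zero.mp h).resolve_left he
  set C := (v ⬝ᵥ v)⁻¹ • (vecMulVec w v - vecMulVec v w) with hC_def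
  have hC : ∀ x, C *ᵥ x = (v ⬝ᵥ v)⁻¹ • ((v ⬝ᵥ x) • w - (w ⬝ᵥ x) • v) := fun x => by
    simp [hC_def, smul_mulVec, sub_mulVec, vecMulVec_mulVec]
  have hCv : (B - C) *ᵥ v = 0 := by
    rw [sub_mulVec, hC, ← hw_def, dotProduct_comm w v, hvw, zero_smul, sub_zero, smul_smul,
      inv_mul_cancel₀ hvv, one_smul, sub_self]
  have hCw : (B - C) *ᵥ w = 0 := by
    rw [sub_mulVec, hC, hBBv, hvw, hww, zero_smul, zero_sub, neg_smul, neg_neg, smul_smul,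
      mul_comm e, inv_mul_cancel_left₀ hvv, sub_self]
  have hker : ∀ x, B *ᵥ x = 0 → C *ᵥ x = 0 := fun x hx => by
    rw [hC, hvx x hx, hwx x hx]
    simp
  refine ⟨C, ?_, ?_, ?_, ?_, hker⟩
  · simp [hC_def, transpose_vecMulVec, ← smul_neg]
  · have hrange : LinearMap.range C.mulVecLin ≤ Submodule.span ℝ (Set.range ![w, v]) := by
      rintro _ ⟨x, rfl⟩
      rw [mulVecLin_apply, hC, range_cons_cons_empty]
      exact Submodule.smul_mem _ _ (Submodule.sub_mem _
        (Submodule.smul_mem _ _ (Submodule.subset_span (by simp)))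
        (Submodule.smul_mem _ _ (Submodule.subset_span (by simp))))
    exact (Submodule.finrank_mono hrange).trans (finrank_range_le_card ![w, v])
  · simp only [hC_def, mul_smul_comm, mul_sub, mul_vecMulVec] at hCv hCw ⊢
    rw [hCv, hCw]
    simp
  · refine rank_add_two_le_of_ker_le hv hw hvw hCv hCw hvx hwx fun x hx => ?_
    rw [sub_mulVec, hx, hker x hx, sub_zero]

theorem Matrix.exists_invariant_decomposition_of_rank_le (k : ℕ) (B : Matrix m m ℝ)
    (hB : Bᵀ = -B) (hk : B.rank ≤ 2 * k + 1) :
    ∃ C : Fin k → Matrix m m ℝ,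
      B = ∑ i, C i ∧ (∀ i, (C i)ᵀ = -(C i)) ∧ (∀ i, (C i).rank ≤ 2) ∧
        (∀ i j, i ≠ j → C i * C j = 0) ∧ ∀ i x, B *ᵥ x = 0 → C i *ᵥ x = 0 := by
  induction k generalizing B with
  | zero =>
    have hB0 : B = 0 := by
      by_contra hB0
      obtain ⟨C, -, -, -, hr, -⟩ := exists_rank_two_summand_of_transpose_eq_neg hB hB0
      omega
    exact ⟨0, by simp [hB0], by simp, by simp, by simp, by simp⟩
  | succ k ih =>
    rcases eq_or_ne B 0 with rfl | hB0
    · exact ⟨0, by simp, by simp, by simp, by simp, by simp⟩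
    obtain ⟨D, hD, hDr, hDD, hr, hker⟩ := exists_rank_two_summand_of_transpose_eq_neg hB hB0
    obtain ⟨C, hsum, hskew, hrank, hmul, hCker⟩ :=
      ih (B - D) (by rw [transpose_sub, hB, hD]; abel) (by omega)
    have hCD : ∀ i, C i * D = 0 := fun i => by
      classical
      refine ext_of_mulVec_single fun j => ?_
      rw [← mulVec_mulVec, zero_mulVec]
      exact hCker i _ (by rw [mulVec_mulVec, hDD, zero_mulVec])
    have hDC : ∀ i, D * C i = 0 := fun i => by
      have h := congrArg transpose (hCD i)
      rwa [transpose_mul, hD, hskew, neg_mul_neg, transpose_zero] at h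
    refine ⟨Fin.cons D C, ?_, ?_, ?_, ?_, ?_⟩
    · rw [Fin.sum_univ_succ]
      simp [← hsum]
    · exact Fin.cases hD hskew
    · exact Fin.cases hDr hrank
    · intro i j
      refine Fin.cases ?_ (fun i => ?_) i <;> refine Fin.cases ?_ (fun j => ?_) j
      · simp
      · simpa using fun _ => hDC j
      · simpa using hCD i
      · simpa using hmul i j
    · refine Fin.cases hker fun i x hx => ?_
      exact hCker i x (by rw [sub_mulVec, hx, hker x hx, sub_zero])

end SkewSymmetric

/-- **Invariant decomposition (matrix form).** Every real skew-symmetric `n × n` matrix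
is a sum of at most `⌊n/2⌋` skew-symmetric matrices of rank at most `2` whose pairwise
products vanish. -/
theorem skew_symmetric_invariant_decomposition (n : ℕ) (B : Matrix (Fin n) (Fin n) ℝ)
    (hB : Bᵀ = -B) :
    ∃ C : Fin (n / 2) → Matrix (Fin n) (Fin n) ℝ,
      B = ∑ i, C i ∧ (∀ i, (C i)ᵀ = -(C i)) ∧ (∀ i, (C i).rank ≤ 2) ∧
        ∀ i j, i ≠ j → C i * C j = 0 := by
  obtain ⟨C, hsum, hskew, hrank, hmul, -⟩ :=
    exists_invariant_decomposition_of_rank_le (n / 2) B hB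
      (B.rank_le_width.trans (by omega))
  exact ⟨C, hsum, hskew, hrank, hmul⟩
end
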